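/- For every τ in the complex upper half-plane, θ[1/5,1/5](τ)·( ζ₅³·θ[1/5,3/5](τ)²·θ[1/5,7/5](τ) + θ[1/5,1](τ)·θ[1/5,9/5](τ)² )² = ( θ[1/5,3/5](τ)·θ[1/5,7/5](τ)³ − θ[1/5,1](τ)³·θ[1/5,9/5](τ) )·( θ[1/5,7/5](τ)²·θ[1/5,9/5](τ) + ζ₅³·θ[1/5,3/5](τ)·θ[1/5,1](τ)² ). -/

import Mathlib

open Complex

/-- The theta constant with characteristic `[ε; ε']`:
`θ[ε,ε'](τ) = ∑_{n ∈ ℤ} exp(2πi((1/2)(n+ε/2)²τ + (n+ε/2)(ε'/2)))`. -/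
noncomputable def θ (ε ε' : ℝ) (τ : ℂ) : ℂ :=
  ∑' n : ℤ, Complex.exp (2 * Real.pi * Complex.I *
    ((1 / 2) * ((n : ℂ) + (ε : ℂ) / 2) ^ 2 * τ + ((n : ℂ) + (ε : ℂ) / 2) * ((ε' : ℂ) / 2)))

/-- `ζ₅ = exp(2πi/5)`. -/
noncomputable def ζ₅ : ℂ := Complex.exp (2 * Real.pi * Complex.I / 5)

open Filter Topology

/-- The theta series with characteristic shift `a` and argument `z`. -/
noncomputable def charTheta (a z τ : ℂ) : ℂ :=
  ∑' n : ℤ, cexp (Real.pi * I * ((n + a) ^ 2 * τ + 2 * (n + a) * z))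

lemma charTheta_term_eq (a z τ : ℂ) (n : ℤ) :
    cexp (Real.pi * I * ((n + a) ^ 2 * τ + 2 * (n + a) * z)) =
      cexp (Real.pi * I * (a ^ 2 * τ + 2 * a * z)) * jacobiTheta₂_term n (z + a * τ) τ := by
  rw [jacobiTheta₂_term, ← Complex.exp_add]
  congr 1
  ring

lemma charTheta_eq_jacobiTheta₂ (a z τ : ℂ) :
    charTheta a z τ =
      cexp (Real.pi * I * (a ^ 2 * τ + 2 * a * z)) * jacobiTheta₂ (z + a * τ) τ := by
  simp_rw [charTheta, charTheta_term_eq, tsum_mul_left, jacobiTheta₂]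

lemma summable_charTheta_term (a z : ℂ) {τ : ℂ} (hτ : 0 < τ.im) :
    Summable fun n : ℤ ↦ cexp (Real.pi * I * ((n + a) ^ 2 * τ + 2 * (n + a) * z)) := by
  simp_rw [charTheta_term_eq]
  exact ((summable_jacobiTheta₂_term_iff _ _).2 hτ).mul_left _

lemma hasSum_charTheta_mul (a b z w : ℂ) {τ : ℂ} (hτ : 0 < τ.im) :
    HasSum (fun p : ℤ × ℤ ↦ cexp (Real.pi * I * ((p.1 + a) ^ 2 * τ + 2 * (p.1 + a) * z)) *
      cexp (Real.pi * I * ((p.2 + b) ^ 2 * τ + 2 * (p.2 + b) * w)))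
      (charTheta a z τ * charTheta b w τ) := by
  have h₁ := (summable_charTheta_term a z hτ).norm
  have h₂ := (summable_charTheta_term b w hτ).norm
  rw [charTheta, charTheta, tsum_mul_tsum_of_summable_norm h₁ h₂]
  exact (summable_mul_of_summable_norm h₁ h₂).hasSum

lemma differentiableAt_charTheta (a z : ℂ) {τ : ℂ} (hτ : 0 < τ.im) :
    DifferentiableAt ℂ (charTheta a z) τ := by
  have h : DifferentiableAt ℂ (fun t ↦ jacobiTheta₂ (z + a * t) t) τ :=
    (hasFDerivAt_jacobiTheta₂ (z + a * τ) hτ).differentiableAt.comp τ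
      (f := fun t : ℂ ↦ ((z + a * t, t) : ℂ × ℂ)) (by fun_prop)
  rw [show charTheta a z = _ from funext (charTheta_eq_jacobiTheta₂ a z)]
  fun_prop

lemma charTheta_add_one_left (a z τ : ℂ) : charTheta (a + 1) z τ = charTheta a z τ := by
  rw [charTheta, charTheta, ← (Equiv.addRight (1 : ℤ)).tsum_eq
    (fun n : ℤ ↦ cexp (Real.pi * I * ((n + a) ^ 2 * τ + 2 * (n + a) * z)))]
  refine tsum_congr fun n ↦ ?_
  simp only [Equiv.coe_addRight, Int.cast_add, Int.cast_one]
  ring_nf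

lemma charTheta_add_one (a z τ : ℂ) :
    charTheta a (z + 1) τ = cexp (2 * Real.pi * I * a) * charTheta a z τ := by
  rw [charTheta, charTheta, ← tsum_mul_left]
  refine tsum_congr fun n ↦ ?_
  rw [← Complex.exp_add, Complex.exp_eq_exp_iff_exists_int]
  exact ⟨n, by ring⟩

lemma charTheta_neg (a z τ : ℂ) : charTheta (-a) (-z) τ = charTheta a z τ := by
  rw [charTheta, charTheta, ← (Equiv.neg ℤ).tsum_eq
    (fun n : ℤ ↦ cexp (Real.pi * I * ((n + a) ^ 2 * τ + 2 * (n + a) * z)))]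
  refine tsum_congr fun n ↦ ?_
  simp only [Equiv.neg_apply, Int.cast_neg]
  ring_nf

/-- Pairs of integers, split according to the parity of their sum. -/
lemma bijective_parity_split :
    Function.Bijective (Sum.elim (fun p : ℤ × ℤ ↦ (p.1 + p.2, p.1 - p.2))
      (fun p : ℤ × ℤ ↦ (p.1 + p.2 + 1, p.1 - p.2))) := by
  constructor
  · rintro (⟨a, b⟩ | ⟨a, b⟩) (⟨c, d⟩ | ⟨c, d⟩) h <;>
      simp only [Sum.elim_inl, Sum.elim_inr, Prod.mk.injEq] at h <;>
      first
        | (exfalso; omega)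
        | (congr 2 <;> omega)
  · rintro ⟨m, n⟩
    rcases Int.even_or_odd' (m + n) with ⟨k, hk | hk⟩
    · exact ⟨Sum.inl (k, m - k), by simp only [Sum.elim_inl, Prod.mk.injEq]; omega⟩
    · exact ⟨Sum.inr (k, m - k - 1), by simp only [Sum.elim_inr, Prod.mk.injEq]; omega⟩

/-- The addition formula expressing products of theta series through theta series at `2τ`. -/
lemma charTheta_add_mul_charTheta_sub (a x y : ℂ) {τ : ℂ} (hτ : 0 < τ.im) :
    charTheta a (x + y) τ * charTheta a (x - y) τ =
      charTheta a (2 * x) (2 * τ) * charTheta 0 (2 * y) (2 * τ) +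
        charTheta (a + 1 / 2) (2 * x) (2 * τ) * charTheta (1 / 2) (2 * y) (2 * τ) := by
  have h2τ : 0 < (2 * τ).im := by simpa using hτ
  refine ((Equiv.ofBijective _ bijective_parity_split).hasSum_iff.2
    (hasSum_charTheta_mul a a (x + y) (x - y) hτ)).unique (HasSum.sum ?_ ?_)
  · convert! hasSum_charTheta_mul a 0 (2 * x) (2 * y) h2τ using 2 with p
    simp only [Function.comp_apply, Equiv.ofBijective_apply, Sum.elim_inl, ← Complex.exp_add]
    push_cast
    ring_nf
  · convert! hasSum_charTheta_mul (a + 1 / 2) (1 / 2) (2 * x) (2 * y) h2τ using 2 with p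
    simp only [Function.comp_apply, Equiv.ofBijective_apply, Sum.elim_inr, ← Complex.exp_add]
    push_cast
    ring_nf

/-- The odd theta function. -/
noncomputable def oddTheta (z τ : ℂ) : ℂ := charTheta (1 / 2) (z + 1 / 2) τ

lemma charTheta_half_add_one (z τ : ℂ) :
    charTheta (1 / 2) (z + 1) τ = -charTheta (1 / 2) z τ := by
  rw [charTheta_add_one, show 2 * (Real.pi : ℂ) * I * (1 / 2) = Real.pi * I by ring,
    Complex.exp_pi_mul_I, neg_one_mul]

lemma oddTheta_add_one (z τ : ℂ) : oddTheta (z + 1) τ = -oddTheta z τ := by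
  rw [oddTheta, oddTheta, ← charTheta_half_add_one]
  ring_nf

lemma oddTheta_neg (z τ : ℂ) : oddTheta (-z) τ = -oddTheta z τ := by
  have h := charTheta_half_add_one (z - 1 / 2) τ
  rw [oddTheta, oddTheta, ← charTheta_neg, ← charTheta_add_one_left,
    show (-(1 / 2) + 1 : ℂ) = 1 / 2 by ring, show -(-z + 1 / 2) = z - 1 / 2 by ring,
    show z + 1 / 2 = z - 1 / 2 + 1 by ring, h, neg_neg]

lemma oddTheta_add_mul_oddTheta_sub (x y : ℂ) {τ : ℂ} (hτ : 0 < τ.im) :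
    oddTheta (x + y) τ * oddTheta (x - y) τ =
      charTheta 0 (2 * x) (2 * τ) * charTheta (1 / 2) (2 * y) (2 * τ) -
        charTheta (1 / 2) (2 * x) (2 * τ) * charTheta 0 (2 * y) (2 * τ) := by
  have h := charTheta_add_mul_charTheta_sub (1 / 2) (x + 1 / 2) y hτ
  rw [show (1 / 2 + 1 / 2 : ℂ) = 0 + 1 by ring, charTheta_add_one_left,
    show 2 * (x + 1 / 2) = 2 * x + 1 by ring, charTheta_half_add_one,
    charTheta_add_one, mul_zero, Complex.exp_zero] at h
  rw [oddTheta, oddTheta, show x + y + 1 / 2 = x + 1 / 2 + y by ring,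
    show x - y + 1 / 2 = x + 1 / 2 - y by ring, h]
  ring

/-- The three-term (Weierstrass) identity. -/
lemma charTheta_three_term (a x u v w : ℂ) {τ : ℂ} (hτ : 0 < τ.im) :
    charTheta a (x + u) τ * charTheta a (x - u) τ *
        (oddTheta (v + w) τ * oddTheta (v - w) τ) +
      charTheta a (x + v) τ * charTheta a (x - v) τ *
        (oddTheta (w + u) τ * oddTheta (w - u) τ) +
      charTheta a (x + w) τ * charTheta a (x - w) τ *
        (oddTheta (u + v) τ * oddTheta (u - v) τ) = 0 := by
  simp only [charTheta_add_mul_charTheta_sub _ _ _ hτ, oddTheta_add_mul_oddTheta_sub _ _ hτ]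
  ring

lemma charTheta_fifth_relation (a x : ℂ) {τ : ℂ} (hτ : 0 < τ.im) :
    charTheta a x τ ^ 2 * (oddTheta (1 / 5) τ * oddTheta (2 / 5) τ) -
      charTheta a (x + 1 / 5) τ * charTheta a (x - 1 / 5) τ * oddTheta (2 / 5) τ ^ 2 +
      charTheta a (x + 2 / 5) τ * charTheta a (x - 2 / 5) τ * oddTheta (1 / 5) τ ^ 2 = 0 := by
  have h := charTheta_three_term a x 0 (1 / 5) (2 / 5) hτ
  rw [show (1 / 5 + 2 / 5 : ℂ) = -(2 / 5) + 1 by ring, oddTheta_add_one, oddTheta_neg,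
    show (1 / 5 - 2 / 5 : ℂ) = -(1 / 5) by ring, oddTheta_neg] at h
  simp only [add_zero, sub_zero, zero_add, zero_sub, oddTheta_neg] at h
  linear_combination -h

lemma tendsto_jacobiTheta₂_atTop (a w : ℝ) (ha : ∀ n : ℤ, 0 ≤ (n : ℝ) ^ 2 + 2 * a * n) :
    Tendsto (fun y : ℝ ↦ jacobiTheta₂ (w + a * (I * y)) (I * y)) atTop
      (𝓝 (∑' n : ℤ, if (n : ℝ) ^ 2 + 2 * a * n = 0 then cexp (2 * Real.pi * I * n * w) else 0)) := by
  have hterm (y : ℝ) (n : ℤ) : jacobiTheta₂_term n (w + a * (I * y)) (I * y) =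
      cexp (2 * Real.pi * I * n * w) *
        (Real.exp (-(Real.pi * ((n : ℝ) ^ 2 + 2 * a * n) * y)) : ℝ) := by
    rw [jacobiTheta₂_term, Complex.ofReal_exp, ← Complex.exp_add]
    congr 1
    push_cast
    linear_combination (Real.pi * (n ^ 2 + 2 * a * n) * y : ℂ) * I_sq
  have hsum : Summable fun n : ℤ ↦ ‖jacobiTheta₂_term n (w + a * (I * (1 : ℝ))) (I * (1 : ℝ))‖ :=
    ((summable_jacobiTheta₂_term_iff _ _).2 (by simp)).norm
  refine tendsto_tsum_of_dominated_convergence hsum (fun n ↦ ?_) ?_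
  · simp_rw [hterm]
    split_ifs with h
    · simp [h]
    · have hpos : 0 < Real.pi * ((n : ℝ) ^ 2 + 2 * a * n) :=
        mul_pos Real.pi_pos (lt_of_le_of_ne (ha n) (Ne.symm h))
      have h0 : Tendsto (fun y : ℝ ↦ Real.exp (-(Real.pi * ((n : ℝ) ^ 2 + 2 * a * n) * y)))
          atTop (𝓝 0) :=
        Real.tendsto_exp_neg_atTop_nhds_zero.comp (tendsto_id.const_mul_atTop hpos)
      simpa using (tendsto_const_nhds (x := cexp (2 * Real.pi * I * n * w))).mul
        ((Complex.continuous_ofReal.tendsto 0).comp h0)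
  · filter_upwards [eventually_ge_atTop 1] with y hy n
    simp only [hterm, norm_mul, Complex.norm_real, Real.norm_eq_abs, Real.abs_exp]
    gcongr
    exact mul_nonneg Real.pi_pos.le (ha n)

lemma exists_charTheta_ne_zero (a w : ℝ) (ha : ∀ n : ℤ, 0 ≤ (n : ℝ) ^ 2 + 2 * a * n)
    (hw : ∑' n : ℤ, (if (n : ℝ) ^ 2 + 2 * a * n = 0 then cexp (2 * Real.pi * I * n * w) else 0)
      ≠ 0) :
    ∃ τ : ℂ, 0 < τ.im ∧ charTheta a w τ ≠ 0 := by
  obtain ⟨y, hy, hy0⟩ := (((tendsto_jacobiTheta₂_atTop a w ha).eventually_ne hw).and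
    (eventually_gt_atTop 0)).exists
  refine ⟨I * y, by simpa using hy0, ?_⟩
  rw [charTheta_eq_jacobiTheta₂]
  exact mul_ne_zero (Complex.exp_ne_zero _) hy

lemma exists_charTheta_tenth_ne_zero :
    ∃ τ : ℂ, 0 < τ.im ∧ charTheta (1 / 10) (1 / 10) τ ≠ 0 := by
  have hz (n : ℤ) (hn : n ≠ 0) : 0 < (n : ℝ) ^ 2 + 2 * (1 / 10 : ℝ) * n := by
    have h : (0 : ℝ) < 5 * n ^ 2 + n := by
      exact_mod_cast (show (0 : ℤ) < 5 * n ^ 2 + n by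
        rcases lt_or_gt_of_ne hn with h | h <;> nlinarith)
    linarith
  obtain ⟨τ, hτ, h⟩ := exists_charTheta_ne_zero (1 / 10) (1 / 10) (fun n ↦ by
      rcases eq_or_ne n 0 with rfl | hn
      · simp
      · exact (hz n hn).le) (by
    rw [tsum_eq_single 0 fun n hn ↦ if_neg (hz n hn).ne']
    simp)
  exact ⟨τ, hτ, by simpa using h⟩

lemma exists_oddTheta_fifth_ne_zero : ∃ τ : ℂ, 0 < τ.im ∧ oddTheta (1 / 5) τ ≠ 0 := by
  have hz (n : ℤ) : (n : ℝ) ^ 2 + 2 * (1 / 2 : ℝ) * n = ((n * (n + 1) : ℤ) : ℝ) := by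
    push_cast
    ring
  obtain ⟨τ, hτ, h⟩ := exists_charTheta_ne_zero (1 / 2) (7 / 10) (fun n ↦ by
      rw [hz]
      exact_mod_cast (show (0 : ℤ) ≤ n * (n + 1) by
        rcases le_or_gt 0 n with h | h <;> nlinarith)) (by
    simp_rw [hz, Int.cast_eq_zero]
    rw [tsum_eq_sum (s := {0, -1}) fun n hn ↦ if_neg fun h ↦ hn (by
      rcases mul_eq_zero.1 h with h | h
      · simp [h]
      · simp [eq_neg_of_add_eq_zero_left h])]
    simp only [Finset.sum_pair (show (0 : ℤ) ≠ -1 by decide)]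
    norm_num
    intro h
    have him := congrArg Complex.im h
    rw [show -(2 * (Real.pi : ℂ) * I * (7 / 10)) =
        ((3 * Real.pi / 5 - 2 * Real.pi : ℝ) : ℂ) * I by push_cast; ring] at him
    rw [Complex.add_im, Complex.exp_ofReal_mul_I_im, Real.sin_sub_two_pi] at him
    have : 0 < Real.sin (3 * Real.pi / 5) :=
      Real.sin_pos_of_pos_of_lt_pi (by positivity) (by linarith [Real.pi_pos])
    simp at him
    linarith)
  refine ⟨τ, hτ, ?_⟩
  rw [oddTheta]
  convert h using 2 <;> norm_num

lemma θ_eq_charTheta (ε ε' : ℝ) (τ : ℂ) : θ ε ε' τ = charTheta (ε / 2) (ε' / 2) τ := by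
  rw [θ, charTheta]
  refine tsum_congr fun n ↦ ?_
  congr 1
  ring

lemma differentiableAt_θ (ε ε' : ℝ) {τ : ℂ} (hτ : 0 < τ.im) : DifferentiableAt ℂ (θ ε ε') τ := by
  rw [show θ ε ε' = _ from funext (θ_eq_charTheta ε ε')]
  exact differentiableAt_charTheta _ _ hτ

lemma resultant_relation_one {τ : ℂ} (hτ : 0 < τ.im) :
    θ (1/5) 1 τ ^ 2 * (oddTheta (1 / 5) τ * oddTheta (2 / 5) τ) -
      θ (1/5) (7/5) τ * θ (1/5) (3/5) τ * oddTheta (2 / 5) τ ^ 2 +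
      θ (1/5) (9/5) τ * θ (1/5) (1/5) τ * oddTheta (1 / 5) τ ^ 2 = 0 := by
  have h := charTheta_fifth_relation (1 / 10) (1 / 2) hτ
  simp only [θ_eq_charTheta]
  norm_num at h ⊢
  exact h

lemma resultant_relation_seven_fifths {τ : ℂ} (hτ : 0 < τ.im) :
    θ (1/5) (7/5) τ ^ 2 * (oddTheta (1 / 5) τ * oddTheta (2 / 5) τ) -
      θ (1/5) (9/5) τ * θ (1/5) 1 τ * oddTheta (2 / 5) τ ^ 2 -
      ζ₅ ^ 3 * θ (1/5) (1/5) τ * θ (1/5) (3/5) τ * oddTheta (1 / 5) τ ^ 2 = 0 := by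
  have hζ : cexp (2 * Real.pi * I * (1 / 10)) = -ζ₅ ^ 3 := by
    rw [ζ₅, ← Complex.exp_nat_mul, ← neg_one_mul, ← Complex.exp_neg_pi_mul_I, ← Complex.exp_add]
    congr 1
    push_cast
    ring
  have h := charTheta_fifth_relation (1 / 10) (7 / 10) hτ
  rw [show (7 / 10 + 2 / 5 : ℂ) = 1 / 10 + 1 by norm_num, charTheta_add_one, hζ] at h
  simp only [θ_eq_charTheta]
  norm_num at h ⊢
  linear_combination h

/-- Elimination of `q / p` between two quadratic relations sharing the factor `A`. -/
lemma resultant_eq_zero_of_common_root {A B C D E ζ p q : ℂ}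
    (h₁ : C ^ 2 * (p * q) - D * B * q ^ 2 + E * A * p ^ 2 = 0)
    (h₂ : D ^ 2 * (p * q) - E * C * q ^ 2 - ζ * A * B * p ^ 2 = 0) :
    p ^ 3 * A * (A * (ζ * B ^ 2 * D + C * E ^ 2) ^ 2 -
      (B * D ^ 3 - C ^ 3 * E) * (D ^ 2 * E + ζ * B * C ^ 2)) = 0 := by
  linear_combination
    (A * (ζ * B ^ 2 * D + C * E ^ 2) * p - (C ^ 3 * E - B * D ^ 3) * q) *
      (C * E * h₁ - B * D * h₂) +
    p * (C ^ 3 * E - B * D ^ 3) * (D ^ 2 * h₁ - C ^ 2 * h₂)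

lemma analyticOnNhd_upperHalfPlane {f : ℂ → ℂ}
    (hf : ∀ t : ℂ, 0 < t.im → DifferentiableAt ℂ f t) :
    AnalyticOnNhd ℂ f {t : ℂ | 0 < t.im} :=
  DifferentiableOn.analyticOnNhd (fun t ht ↦ (hf t ht).differentiableWithinAt)
    UpperHalfPlane.isOpen_upperHalfPlaneSet

theorem resultant_rational_onefifth (τ : ℂ) (hτ : 0 < τ.im) :
    θ (1/5) (1/5) τ * (ζ₅ ^ 3 * θ (1/5) (3/5) τ ^ 2 * θ (1/5) (7/5) τ + θ (1/5) 1 τ * θ (1/5) (9/5) τ ^ 2) ^ 2 = (θ (1/5) (3/5) τ * θ (1/5) (7/5) τ ^ 3 - θ (1/5) 1 τ ^ 3 * θ (1/5) (9/5) τ) * (θ (1/5) (7/5) τ ^ 2 * θ (1/5) (9/5) τ + ζ₅ ^ 3 * θ (1/5) (3/5) τ * θ (1/5) 1 τ ^ 2) := by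
  have hA : AnalyticOnNhd ℂ (θ (1/5) (1/5)) {t : ℂ | 0 < t.im} :=
    analyticOnNhd_upperHalfPlane fun _ ht ↦ differentiableAt_θ _ _ ht
  have hP : AnalyticOnNhd ℂ (fun t ↦ oddTheta (1 / 5) t ^ 3) {t : ℂ | 0 < t.im} :=
    analyticOnNhd_upperHalfPlane fun _ ht ↦ (differentiableAt_charTheta _ _ ht).pow 3
  have hR : AnalyticOnNhd ℂ (fun t ↦
      θ (1/5) (1/5) t * (ζ₅ ^ 3 * θ (1/5) (3/5) t ^ 2 * θ (1/5) (7/5) t +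
        θ (1/5) 1 t * θ (1/5) (9/5) t ^ 2) ^ 2 -
      (θ (1/5) (3/5) t * θ (1/5) (7/5) t ^ 3 - θ (1/5) 1 t ^ 3 * θ (1/5) (9/5) t) *
        (θ (1/5) (7/5) t ^ 2 * θ (1/5) (9/5) t + ζ₅ ^ 3 * θ (1/5) (3/5) t * θ (1/5) 1 t ^ 2))
      {t : ℂ | 0 < t.im} := by
    refine analyticOnNhd_upperHalfPlane fun t ht ↦ ?_
    have h₁ := differentiableAt_θ (1/5) (1/5) ht
    have h₃ := differentiableAt_θ (1/5) (3/5) ht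
    have h₅ := differentiableAt_θ (1/5) 1 ht
    have h₇ := differentiableAt_θ (1/5) (7/5) ht
    have h₉ := differentiableAt_θ (1/5) (9/5) ht
    fun_prop
  have hconn : IsPreconnected {t : ℂ | 0 < t.im} := (convex_halfSpace_im_gt 0).isPreconnected
  have hprod : ∀ t ∈ {t : ℂ | 0 < t.im}, θ (1/5) (1/5) t * (oddTheta (1 / 5) t ^ 3 *
      (θ (1/5) (1/5) t * (ζ₅ ^ 3 * θ (1/5) (3/5) t ^ 2 * θ (1/5) (7/5) t +
        θ (1/5) 1 t * θ (1/5) (9/5) t ^ 2) ^ 2 -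
      (θ (1/5) (3/5) t * θ (1/5) (7/5) t ^ 3 - θ (1/5) 1 t ^ 3 * θ (1/5) (9/5) t) *
        (θ (1/5) (7/5) t ^ 2 * θ (1/5) (9/5) t +
          ζ₅ ^ 3 * θ (1/5) (3/5) t * θ (1/5) 1 t ^ 2))) = 0 := by
    intro t ht
    have h := resultant_eq_zero_of_common_root (resultant_relation_one ht)
      (resultant_relation_seven_fifths ht)
    linear_combination h
  rcases hA.eq_zero_or_eq_zero_of_mul_eq_zero (hP.mul hR) hprod hconn with h | h
  · obtain ⟨t, ht, hne⟩ := exists_charTheta_tenth_ne_zero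
    refine absurd (h t ht) ?_
    rw [θ_eq_charTheta]
    convert hne using 2
    all_goals norm_num
  rcases hP.eq_zero_or_eq_zero_of_mul_eq_zero hR h hconn with h | h
  · obtain ⟨t, ht, hne⟩ := exists_oddTheta_fifth_ne_zero
    exact absurd (h t ht) (pow_ne_zero 3 hne)
  · exact sub_eq_zero.1 (h τ hτ)
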